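/- Let U ⊆ ℝ⁴ be a contractible open set. Then the Engel complex is exact at its final term: for every smooth function ρ : U → ℝ there exist smooth functions g, h : U → ℝ such that Xh − Yg = ρ on U. -/

import Mathlib

/-- Engel operator `X = ∂/∂x` on `ℝ⁴` with coordinates `(x, y, z, t)`. -/
noncomputable def opX (f : (Fin 4 → ℝ) → ℝ) : (Fin 4 → ℝ) → ℝ :=
  fun p => fderiv ℝ f p ![1, 0, 0, 0]

/-- Engel operator `Y = ∂/∂z + x ∂/∂t + x² ∂/∂y` on `ℝ⁴`. -/
noncomputable def opY (f : (Fin 4 → ℝ) → ℝ) : (Fin 4 → ℝ) → ℝ :=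
  fun p => fderiv ℝ f p ![0, (p 0) ^ 2, 1, p 0]

/-- Engel operator `Z = [X, Y] = ∂/∂t + 2x ∂/∂y` on `ℝ⁴`. -/
noncomputable def opZ (f : (Fin 4 → ℝ) → ℝ) : (Fin 4 → ℝ) → ℝ :=
  fun p => fderiv ℝ f p ![0, 2 * p 0, 0, 1]

/-- Engel operator `W = [X, Z] = 2 ∂/∂y` on `ℝ⁴`. -/
noncomputable def opW (f : (Fin 4 → ℝ) → ℝ) : (Fin 4 → ℝ) → ℝ :=
  fun p => fderiv ℝ f p ![0, 2, 0, 0]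

open Set Topology
open scoped ContDiff Manifold

section ParametricIntegral

variable {E F : Type*} [NormedAddCommGroup E] [NormedSpace ℝ E] [NormedAddCommGroup F]
  [NormedSpace ℝ F]

theorem ContDiffOn.hasFDerivAt_comp_prodMk {U : Set E} (hU : IsOpen U) {f : E × ℝ → F}
    (hf : ContDiffOn ℝ 1 f (U ×ˢ univ)) {p : E} (hp : p ∈ U) (t : ℝ) :
    HasFDerivAt (fun q => f (q, t)) ((fderiv ℝ f (p, t)).comp (.inl ℝ E ℝ)) p := by
  have h : HasFDerivAt f (fderiv ℝ f (p, t)) (p, t) :=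
    ((hf.contDiffAt ((hU.prod isOpen_univ).mem_nhds ⟨hp, mem_univ t⟩)).differentiableAt
      one_ne_zero).hasFDerivAt
  exact h.comp p (hasFDerivAt_prodMk_left p t)

theorem hasFDerivAt_integral_of_contDiffOn [LocallyCompactSpace E] {U : Set E} (hU : IsOpen U)
    {f : E × ℝ → F} (hf : ContDiffOn ℝ 1 f (U ×ˢ univ)) {p : E} (hp : p ∈ U) (a b : ℝ) :
    HasFDerivAt (fun q => ∫ t in a..b, f (q, t))
      (∫ t in a..b, (fderiv ℝ f (p, t)).comp (.inl ℝ E ℝ)) p := by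
  have hopen : IsOpen (U ×ˢ (univ : Set ℝ)) := hU.prod isOpen_univ
  have hline {q : E} (hq : q ∈ U) : Continuous fun t : ℝ => f (q, t) :=
    hf.continuousOn.comp_continuous (by fun_prop) fun t => ⟨hq, mem_univ t⟩
  have hf' : ContinuousOn (fun z => (fderiv ℝ f z).comp (.inl ℝ E ℝ)) (U ×ˢ univ) :=
    (hf.continuousOn_fderiv_of_isOpen hopen le_rfl).clm_comp continuousOn_const
  have hline' : Continuous fun t : ℝ => (fderiv ℝ f (p, t)).comp (.inl ℝ E ℝ) :=
    hf'.comp_continuous (by fun_prop) fun t => ⟨hp, mem_univ t⟩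
  obtain ⟨K, hK, hKU, hKc⟩ := local_compact_nhds (hU.mem_nhds hp)
  obtain ⟨C, hC⟩ := (hKc.prod (isCompact_uIcc (a := a) (b := b))).exists_bound_of_continuousOn
    (hf'.mono (prod_mono hKU (subset_univ _)))
  refine intervalIntegral.hasFDerivAt_integral_of_dominated_of_fderiv_le (bound := fun _ => C)
    (F' := fun q t => (fderiv ℝ f (q, t)).comp (.inl ℝ E ℝ)) hK ?_
    ((hline hp).intervalIntegrable _ _) hline'.aestronglyMeasurable ?_ (by simp) ?_
  · filter_upwards [hU.mem_nhds hp] with q hq using (hline hq).aestronglyMeasurable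
  · exact .of_forall fun t ht q hq => hC (q, t) ⟨hq, uIoc_subset_uIcc ht⟩
  · exact .of_forall fun t _ q hq => hf.hasFDerivAt_comp_prodMk hU (hKU hq) t

end ParametricIntegral

theorem contDiffOn_integral_of_contDiffOn {E F : Type} [NormedAddCommGroup E] [NormedSpace ℝ E]
    [LocallyCompactSpace E] [NormedAddCommGroup F] [NormedSpace ℝ F] {U : Set E} (hU : IsOpen U)
    {f : E × ℝ → F} (hf : ContDiffOn ℝ ∞ f (U ×ˢ univ)) (a b : ℝ) :
    ContDiffOn ℝ ∞ (fun q => ∫ t in a..b, f (q, t)) U := by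
  have hopen : IsOpen (U ×ˢ (univ : Set ℝ)) := hU.prod isOpen_univ
  rw [contDiffOn_infty]
  intro n
  induction n generalizing F with
  | zero =>
    have hd (p : E) (hp : p ∈ U) :=
      hasFDerivAt_integral_of_contDiffOn hU (hf.of_le (by simp)) hp a b
    exact contDiffOn_zero.2 fun p hp => (hd p hp).continuousAt.continuousWithinAt
  | succ n ih =>
    have hd (p : E) (hp : p ∈ U) :=
      hasFDerivAt_integral_of_contDiffOn hU (hf.of_le (by simp)) hp a b
    push_cast
    refine (contDiffOn_succ_iff_fderiv_of_isOpen hU).2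
      ⟨fun p hp => (hd p hp).differentiableAt.differentiableWithinAt, by simp, ?_⟩
    refine (ih (f := fun z => (fderiv ℝ f z).comp (.inl ℝ E ℝ)) ?_).congr
      fun p hp => (hd p hp).fderiv
    exact (hf.fderiv_of_isOpen hopen (by simp)).clm_comp contDiffOn_const

theorem exists_contDiffOn_homotopy_of_contractible {E : Type} [NormedAddCommGroup E]
    [NormedSpace ℝ E] [FiniteDimensional ℝ E] {U : Set E} (hU : IsOpen U) [ContractibleSpace U] :
    ∃ (c : E) (H : E × ℝ → E), ContDiffOn ℝ ∞ H (U ×ˢ univ) ∧ MapsTo H (U ×ˢ univ) U ∧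
      (∀ p ∈ U, H (p, 0) = c) ∧ ∀ p ∈ U, H (p, 1) = p := by
  obtain ⟨c, ⟨G⟩⟩ := id_nullhomotopic U
  let Ω : TopologicalSpace.Opens (E × ℝ) := ⟨U ×ˢ univ, hU.prod isOpen_univ⟩
  let K : Ω → U := fun z => G (projIcc 0 1 zero_le_one (2 - 3 * z.1.2), ⟨z.1.1, z.2.1⟩)
  have hK : Continuous K := by fun_prop
  have hK0 (z : Ω) (hz : z.1.2 ≤ 1 / 3) : K z = c := by
    have : projIcc (0 : ℝ) 1 zero_le_one (2 - 3 * z.1.2) = 1 :=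
      projIcc_of_right_le _ (by linarith)
    simp [K, this]
  have hK1 (z : Ω) (hz : 2 / 3 ≤ z.1.2) : (K z : E) = z.1.1 := by
    have : projIcc (0 : ℝ) 1 zero_le_one (2 - 3 * z.1.2) = 0 :=
      projIcc_of_le_left _ (by linarith)
    simp [K, this]
  let S : Ω → Set E := fun z => {v | v ∈ Metric.eball (K z : E) (Metric.infEDist (K z : E) Uᶜ) ∧
    (z.1.2 ≤ 0 → v = c) ∧ (1 ≤ z.1.2 → v = z.1.1)}
  have hpos (z : Ω) : 0 < Metric.infEDist (K z : E) Uᶜ := by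
    rw [pos_iff_ne_zero, Ne, ← Metric.mem_closure_iff_infEDist_zero,
      hU.isClosed_compl.closure_eq]
    exact fun h => h (K z).2
  have hconv (P : Prop) (w : E) : Convex ℝ {v | P → v = w} := by
    by_cases h : P
    · simp [h]
    · simpa [h] using convex_univ
  have hS (z : Ω) : Convex ℝ (S z) := by
    exact (convex_eball _ _).inter ((hconv _ _).inter (hconv _ _))
  have : ProperSpace E := FiniteDimensional.proper_real E
  have : LocallyCompactSpace Ω := Ω.isOpen.locallyCompactSpace
  have hcont : Continuous fun z : Ω => z.1.2 := by fun_prop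
  obtain ⟨g, hg⟩ := exists_contMDiffMap_forall_mem_convex_of_local (n := ⊤) 𝓘(ℝ, E × ℝ) hS
    fun z => by
      rcases lt_or_ge z.1.2 (1 / 3) with h | h
      · refine ⟨_, (isOpen_Iio.preimage hcont).mem_nhds h, fun _ => c, contMDiffOn_const,
          fun y hy => ?_⟩
        have hy' : y.1.2 < 1 / 3 := hy
        refine ⟨?_, fun _ => rfl, fun h1 => by linarith⟩
        have := hpos y
        rw [hK0 y hy'.le] at this ⊢
        simpa using this
      rcases lt_or_ge (2 / 3) z.1.2 with h' | h'
      · refine ⟨_, (isOpen_Ioi.preimage hcont).mem_nhds h', fun y => y.1.1,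
          (contDiff_fst.contMDiff.comp contMDiff_subtype_val).contMDiffOn, fun y hy => ?_⟩
        have hy' : 2 / 3 < y.1.2 := hy
        refine ⟨?_, fun h1 => by linarith, fun _ => rfl⟩
        have := hpos y
        rw [hK1 y hy'.le] at this ⊢
        simpa using this
      · have hopen : IsOpen {y : Ω | edist (K z : E) (K y : E) < Metric.infEDist (K y : E) Uᶜ} :=
          isOpen_lt (by fun_prop) (Metric.continuous_infEDist.comp (by fun_prop))
        refine ⟨_, Filter.inter_mem (hopen.mem_nhds (by simpa using hpos z))
          ((isOpen_Ioo (a := (0 : ℝ)) (b := 1)).preimage hcont |>.mem_nhds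
            ⟨by linarith, by linarith⟩), fun _ => K z, contMDiffOn_const, fun y hy => ?_⟩
        exact ⟨hy.1, fun h0 => absurd hy.2.1 h0.not_gt, fun h1 => absurd hy.2.2 h1.not_gt⟩
  classical
  let H : E × ℝ → E := fun z => if hz : z ∈ Ω then g ⟨z, hz⟩ else 0
  have hH (z : Ω) : H z = g z := dif_pos z.2
  refine ⟨c, H, fun z hz => ?_, fun z hz => ?_, fun p hp => ?_, fun p hp => ?_⟩
  · refine ContDiffAt.contDiffWithinAt (contMDiffAt_iff_contDiffAt.1 ?_)
    refine (contMDiffAt_subtype_iff (U := Ω) (x := ⟨z, hz⟩)).1 ?_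
    exact (g.contMDiff _).congr_of_eventuallyEq (.of_forall hH)
  · by_contra hn
    have h1 := (hg ⟨z, hz⟩).1
    rw [← hH, Metric.mem_eball, edist_comm] at h1
    exact (Metric.infEDist_le_edist_of_mem hn).not_gt h1
  · have hz : (p, (0 : ℝ)) ∈ Ω := ⟨hp, mem_univ _⟩
    exact (hH ⟨_, hz⟩).trans ((hg ⟨_, hz⟩).2.1 le_rfl)
  · have hz : (p, (1 : ℝ)) ∈ Ω := ⟨hp, mem_univ _⟩
    exact (hH ⟨_, hz⟩).trans ((hg ⟨_, hz⟩).2.2 le_rfl)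

theorem sum_fderiv_comp_mul_det_eq_zero {n : ℕ} {G : Type*} [NormedAddCommGroup G]
    [NormedSpace ℝ G] {ρ : (Fin n → ℝ) → ℝ} {H : G → Fin n → ℝ} {z : G}
    (hρ : DifferentiableAt ℝ ρ (H z)) (hH : ContDiffAt ℝ 2 H z) (v : Fin (n + 1) → G) :
    ∑ i : Fin (n + 1), (-1) ^ i.val * fderiv ℝ (fun y => ρ (H y) *
      Matrix.det (.of fun j => fderiv ℝ H y (i.removeNth v j))) z (v i) = 0 := by
  let D : (Fin n → ℝ) [⋀^Fin n]→L[ℝ] ℝ :=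
    { (Matrix.detRowAlternating : (Fin n → ℝ) [⋀^Fin n]→ₗ[ℝ] ℝ) with
      cont := continuous_id.matrix_det }
  let θ : (Fin n → ℝ) → (Fin n → ℝ) [⋀^Fin n]→L[ℝ] ℝ :=
    fun q => ContinuousLinearMap.toSpanSingleton ℝ D (ρ q)
  have hθ : DifferentiableAt ℝ θ (H z) :=
    (ContinuousLinearMap.toSpanSingleton ℝ D).differentiableAt.comp _ hρ
  have hα : DifferentiableAt ℝ
      (fun y => (θ (H y)).compContinuousLinearMap (fderiv ℝ H y)) z :=
    DifferentiableAt.continuousAlternatingMapCompContinuousLinearMap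
      (hθ.comp z (hH.differentiableAt two_ne_zero))
      ((hH.fderiv_right (m := 1) (by norm_num)).differentiableAt one_ne_zero)
  have hpull := congrArg (fun β => β v)
    (extDeriv_pullback hθ hH (by simp [minSmoothness_of_isRCLikeNormedField]))
  rw [extDeriv_apply hα] at hpull
  have hdep : ¬ LinearIndependent ℝ (fun i => fderiv ℝ H z (v i)) := fun h => by
    simpa using h.fintype_card_le_finrank
  have hθ_apply (q) (w : Fin n → Fin n → ℝ) : θ q w = ρ q * Matrix.det (.of w) := rfl
  simp only [ContinuousAlternatingMap.compContinuousLinearMap_apply, hθ_apply, zsmul_eq_mul,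
    Int.cast_pow, Int.cast_neg, Int.cast_one] at hpull
  exact hpull.trans ((extDeriv θ (H z)).toAlternatingMap.map_linearDependent _ hdep)

theorem exists_sum_fderiv_single_eq {n : ℕ} (hn : n ≠ 0) {U : Set (Fin n → ℝ)} (hU : IsOpen U)
    [ContractibleSpace U] {ρ : (Fin n → ℝ) → ℝ} (hρ : ContDiffOn ℝ ∞ ρ U) :
    ∃ F : Fin n → (Fin n → ℝ) → ℝ, (∀ i, ContDiffOn ℝ ∞ (F i) U) ∧
      ∀ p ∈ U, ∑ i, fderiv ℝ (F i) p (Pi.single i 1) = ρ p := by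
  obtain ⟨c, H, hH, hHU, hH0, hH1⟩ := exists_contDiffOn_homotopy_of_contractible hU
  have hopen : IsOpen (U ×ˢ (univ : Set ℝ)) := hU.prod isOpen_univ
  let v : Fin (n + 1) → (Fin n → ℝ) × ℝ := Fin.cons (0, 1) fun i => (Pi.single i 1, 0)
  let f : Fin (n + 1) → (Fin n → ℝ) × ℝ → ℝ := fun i z =>
    ρ (H z) * Matrix.det (.of fun j => fderiv ℝ H z (i.removeNth v j))
  have hf (i : Fin (n + 1)) : ContDiffOn ℝ ∞ (f i) (U ×ˢ univ) := by
    refine (hρ.comp hH hHU).mul ?_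
    have hD := hH.fderiv_of_isOpen hopen (m := ∞) (by simp)
    simp only [Matrix.det_apply']
    refine ContDiffOn.sum fun σ _ => contDiffOn_const.mul (contDiffOn_prod fun j _ => ?_)
    exact contDiffOn_pi.1 (hD.clm_apply contDiffOn_const) j
  have hclosed (z) (hz : z ∈ U ×ˢ (univ : Set ℝ)) :
      fderiv ℝ (f 0) z (0, 1) =
        ∑ i : Fin n, (-1) ^ i.val * fderiv ℝ (f i.succ) z (Pi.single i 1, 0) := by
    have h := sum_fderiv_comp_mul_det_eq_zero
      ((hρ.contDiffAt (hU.mem_nhds (hHU hz))).differentiableAt (by simp))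
      ((hH.contDiffAt (hopen.mem_nhds hz)).of_le ENat.LEInfty.out) v
    rw [Fin.sum_univ_succ] at h
    simp only [Fin.val_zero, pow_zero, one_mul, Fin.val_succ, pow_succ, mul_neg, mul_one,
      neg_mul, Finset.sum_neg_distrib] at h
    exact add_neg_eq_zero.1 h
  have hslice (p) (hp : p ∈ U) (t : ℝ) (w : Fin n → ℝ) :
      fderiv ℝ H (p, t) (w, 0) = fderiv ℝ (fun q => H (q, t)) p w := by
    rw [((hH.of_le (by simp)).hasFDerivAt_comp_prodMk hU hp t).fderiv]
    simp
  have hf0 (p) (hp : p ∈ U) : f 0 (p, 0) = 0 := by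
    have h : fderiv ℝ (fun q => H (q, 0)) p = 0 := by
      rw [Filter.EventuallyEq.fderiv_eq (f := fun _ => c)
        (Filter.eventually_of_mem (hU.mem_nhds hp) hH0)]
      simp
    have hv : (Matrix.of fun j => fderiv ℝ H (p, 0) ((0 : Fin (n + 1)).removeNth v j)) =
        (0 : Matrix (Fin n) (Fin n) ℝ) := by
      ext j k
      simp [v, Fin.removeNth, hslice p hp, h]
    have : Nonempty (Fin n) := Fin.pos_iff_nonempty.1 (Nat.pos_of_ne_zero hn)
    simp only [f, hv, Matrix.det_zero, mul_zero]
  have hf1 (p) (hp : p ∈ U) : f 0 (p, 1) = ρ p := by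
    have h : fderiv ℝ (fun q => H (q, 1)) p = .id ℝ _ := by
      rw [Filter.EventuallyEq.fderiv_eq (f := fun q => q)
        (Filter.eventually_of_mem (hU.mem_nhds hp) hH1)]
      simp
    have hv : (Matrix.of fun j => fderiv ℝ H (p, 1) ((0 : Fin (n + 1)).removeNth v j)) =
        (1 : Matrix (Fin n) (Fin n) ℝ) := by
      ext j k
      simp [v, Fin.removeNth, hslice p hp, h, Matrix.one_apply, Pi.single_apply, eq_comm]
    simp only [f, hv, Matrix.det_one, mul_one, hH1 p hp]
  refine ⟨fun i q => (-1) ^ i.val * ∫ t in (0 : ℝ)..1, f i.succ (q, t),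
    fun i => contDiffOn_const.mul (contDiffOn_integral_of_contDiffOn hU (hf i.succ) 0 1),
    fun p hp => ?_⟩
  have hf' (i : Fin (n + 1)) : Continuous fun t : ℝ => fderiv ℝ (f i) (p, t) :=
    ((hf i).continuousOn_fderiv_of_isOpen hopen (by simp)).comp_continuous (by fun_prop)
      fun t => ⟨hp, mem_univ t⟩
  have hint (i : Fin n) : fderiv ℝ (fun q => (-1) ^ i.val * ∫ t in (0 : ℝ)..1, f i.succ (q, t)) p
      (Pi.single i 1) =
        ∫ t in (0 : ℝ)..1, (-1) ^ i.val * fderiv ℝ (f i.succ) (p, t) (Pi.single i 1, 0) := by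
    have h := hasFDerivAt_integral_of_contDiffOn hU ((hf i.succ).of_le (by simp)) hp 0 1
    rw [(h.const_mul _).fderiv, smul_apply,
      ContinuousLinearMap.intervalIntegral_apply, intervalIntegral.integral_const_mul]
    · simp
    · exact ((hf' i.succ).clm_comp continuous_const).intervalIntegrable _ _
  simp only [hint]
  rw [← intervalIntegral.integral_finsetSum]
  · have hderiv (t : ℝ) : HasDerivAt (fun s => f 0 (p, s)) (fderiv ℝ (f 0) (p, t) (0, 1)) t := by
      have h : HasFDerivAt (f 0) (fderiv ℝ (f 0) (p, t)) (p, t) :=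
        (((hf 0).contDiffAt (hopen.mem_nhds ⟨hp, mem_univ t⟩)).differentiableAt
          (by simp)).hasFDerivAt
      exact h.comp_hasDerivAt t ((hasDerivAt_const t p).prodMk (hasDerivAt_id t))
    simp only [← hclosed (p, _) ⟨hp, mem_univ _⟩]
    rw [intervalIntegral.integral_eq_sub_of_hasDerivAt (fun t _ => hderiv t)
      (((hf' 0).clm_apply continuous_const).intervalIntegrable _ _), hf1 p hp, hf0 p hp, sub_zero]
  · exact fun i _ =>
      (continuous_const.mul ((hf' i.succ).clm_apply continuous_const)).intervalIntegrable _ _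

theorem contDiffOn_opX {U : Set (Fin 4 → ℝ)} (hU : IsOpen U) {f : (Fin 4 → ℝ) → ℝ}
    (hf : ContDiffOn ℝ ∞ f U) : ContDiffOn ℝ ∞ (opX f) U :=
  (hf.fderiv_of_isOpen hU (by simp)).clm_apply contDiffOn_const

theorem contDiffOn_opY {U : Set (Fin 4 → ℝ)} (hU : IsOpen U) {f : (Fin 4 → ℝ) → ℝ}
    (hf : ContDiffOn ℝ ∞ f U) : ContDiffOn ℝ ∞ (opY f) U := by
  refine (hf.fderiv_of_isOpen hU (by simp)).clm_apply (ContDiff.contDiffOn ?_)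
  refine contDiff_pi.2 fun i => ?_
  fin_cases i <;> simp <;> fun_prop

theorem contDiffOn_opZ {U : Set (Fin 4 → ℝ)} (hU : IsOpen U) {f : (Fin 4 → ℝ) → ℝ}
    (hf : ContDiffOn ℝ ∞ f U) : ContDiffOn ℝ ∞ (opZ f) U := by
  refine (hf.fderiv_of_isOpen hU (by simp)).clm_apply (ContDiff.contDiffOn ?_)
  refine contDiff_pi.2 fun i => ?_
  fin_cases i <;> simp <;> fun_prop

theorem fderiv_fderiv_apply_sub {E F : Type*} [NormedAddCommGroup E] [NormedSpace ℝ E]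
    [NormedAddCommGroup F] [NormedSpace ℝ F] {f : E → F} {p : E} {v w : E → E} {v' w' : E →L[ℝ] E}
    (hf : ContDiffAt ℝ 2 f p) (hv : HasFDerivAt v v' p) (hw : HasFDerivAt w w' p) :
    fderiv ℝ (fun q => fderiv ℝ f q (w q)) p (v p) -
      fderiv ℝ (fun q => fderiv ℝ f q (v q)) p (w p) = fderiv ℝ f p (w' (v p) - v' (w p)) := by
  have hf' : HasFDerivAt (fderiv ℝ f) (fderiv ℝ (fderiv ℝ f) p) p :=
    ((hf.fderiv_right (m := 1) (by norm_num)).differentiableAt one_ne_zero).hasFDerivAt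
  have hsymm := (hf.isSymmSndFDerivAt (by simp)).eq (v p) (w p)
  rw [(hf'.clm_apply hw).fderiv, (hf'.clm_apply hv).fderiv]
  simp [hsymm]

theorem opX_opY_sub_opY_opX {f : (Fin 4 → ℝ) → ℝ} {p : Fin 4 → ℝ} (hf : ContDiffAt ℝ 2 f p) :
    opX (opY f) p - opY (opX f) p = opZ f p := by
  let π : (Fin 4 → ℝ) →L[ℝ] ℝ := .proj 0
  have h0 : HasFDerivAt (fun q : Fin 4 → ℝ => q 0) π p := hasFDerivAt_apply 0 p
  have hY : HasFDerivAt (fun q : Fin 4 → ℝ => ![0, (q 0) ^ 2, 1, q 0])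
      (ContinuousLinearMap.pi (φ := fun _ => ℝ) ![0, (2 * p 0) • π, 0, π]) p := by
    refine hasFDerivAt_pi.2 fun i => ?_
    fin_cases i
    · exact hasFDerivAt_const _ _
    · simpa using h0.pow 2
    · exact hasFDerivAt_const _ _
    · exact h0
  refine (fderiv_fderiv_apply_sub hf (hasFDerivAt_const ![1, 0, 0, 0] p) hY).trans ?_
  refine congrArg (fderiv ℝ f p) ?_
  ext i
  fin_cases i <;> simp [π]

theorem opX_opZ_sub_opZ_opX {f : (Fin 4 → ℝ) → ℝ} {p : Fin 4 → ℝ} (hf : ContDiffAt ℝ 2 f p) :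
    opX (opZ f) p - opZ (opX f) p = opW f p := by
  let π : (Fin 4 → ℝ) →L[ℝ] ℝ := .proj 0
  have h0 : HasFDerivAt (fun q : Fin 4 → ℝ => q 0) π p := hasFDerivAt_apply 0 p
  have hZ : HasFDerivAt (fun q : Fin 4 → ℝ => ![0, 2 * q 0, 0, 1])
      (ContinuousLinearMap.pi (φ := fun _ => ℝ) ![0, (2 : ℝ) • π, 0, 0]) p := by
    refine hasFDerivAt_pi.2 fun i => ?_
    fin_cases i
    · exact hasFDerivAt_const _ _
    · exact h0.const_mul 2
    · exact hasFDerivAt_const _ _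
    · exact hasFDerivAt_const _ _
  refine (fderiv_fderiv_apply_sub hf (hasFDerivAt_const ![1, 0, 0, 0] p) hZ).trans ?_
  refine congrArg (fderiv ℝ f p) ?_
  ext i
  fin_cases i <;> simp [π]

theorem engel_exact_final
    (U : Set (Fin 4 → ℝ)) (hU : IsOpen U) (hUc : ContractibleSpace U)
    (ρ : (Fin 4 → ℝ) → ℝ) (hρ : ContDiffOn ℝ (⊤ : ℕ∞) ρ U) :
    ∃ g h : (Fin 4 → ℝ) → ℝ, ContDiffOn ℝ (⊤ : ℕ∞) g U ∧ ContDiffOn ℝ (⊤ : ℕ∞) h U ∧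
      ∀ p ∈ U, opX h p - opY g p = ρ p := by
  obtain ⟨F, hF, hdiv⟩ := exists_sum_fderiv_single_eq four_ne_zero hU hρ
  -- Write `ρ = X (F 0) + Y (F 2) + Z c + W d`, then eliminate `Z = [X, Y]` and `W = [X, Z]`.
  let c : (Fin 4 → ℝ) → ℝ := fun p => F 3 p - p 0 * F 2 p
  let d : (Fin 4 → ℝ) → ℝ := fun p => 2⁻¹ * (F 1 p + p 0 ^ 2 * F 2 p - 2 * p 0 * F 3 p)
  let u : (Fin 4 → ℝ) → ℝ := fun p => c p - opX d p
  have hx : ContDiffOn ℝ ∞ (fun p : Fin 4 → ℝ => p 0) U := by fun_prop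
  have hc : ContDiffOn ℝ ∞ c U := (hF 3).sub (hx.mul (hF 2))
  have hd : ContDiffOn ℝ ∞ d U :=
    contDiffOn_const.mul
      (((hF 1).add ((hx.pow 2).mul (hF 2))).sub ((contDiffOn_const.mul hx).mul (hF 3)))
  have hXd := contDiffOn_opX hU hd
  have hZd := contDiffOn_opZ hU hd
  have hu : ContDiffOn ℝ ∞ u U := hc.sub hXd
  have hXu := contDiffOn_opX hU hu
  have hYu := contDiffOn_opY hU hu
  refine ⟨fun p => opX u p - F 2 p, fun p => F 0 p + opZ d p + opY u p, hXu.sub (hF 2),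
    ((hF 0).add hZd).add hYu, fun p hp => ?_⟩
  have hdiff {f : (Fin 4 → ℝ) → ℝ} (hf : ContDiffOn ℝ ∞ f U) : DifferentiableAt ℝ f p :=
    (hf.contDiffAt (hU.mem_nhds hp)).differentiableAt (by simp)
  have hsmooth {f : (Fin 4 → ℝ) → ℝ} (hf : ContDiffOn ℝ ∞ f U) : ContDiffAt ℝ 2 f p :=
    (hf.contDiffAt (hU.mem_nhds hp)).of_le ENat.LEInfty.out
  have hh : opX (fun p => F 0 p + opZ d p + opY u p) p =
      opX (F 0) p + opX (opZ d) p + opX (opY u) p := by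
    rw [opX, fderiv_fun_add ((hdiff (hF 0)).fun_add (hdiff hZd)) (hdiff hYu),
      fderiv_fun_add (hdiff (hF 0)) (hdiff hZd)]
    rfl
  have hg : opY (fun p => opX u p - F 2 p) p = opY (opX u) p - opY (F 2) p := by
    rw [opY, fderiv_fun_sub (hdiff hXu) (hdiff (hF 2))]
    rfl
  have hZu : opZ u p = opZ c p - opZ (opX d) p := by
    rw [opZ, fderiv_fun_sub (hdiff hc) (hdiff hXd)]
    rfl
  have hXY := opX_opY_sub_opY_opX (hsmooth hu)
  have hXZ := opX_opZ_sub_opZ_opX (hsmooth hd)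
  have hsum : opX (F 0) p + opY (F 2) p + opZ c p + opW d p = ρ p := by
    have h0 : HasFDerivAt (fun q : Fin 4 → ℝ => q 0)
      (ContinuousLinearMap.proj (R := ℝ) (φ := fun _ : Fin 4 => ℝ) 0) p := hasFDerivAt_apply 0 p
    have hF' (i : Fin 4) : HasFDerivAt (F i) (fderiv ℝ (F i) p) p := (hdiff (hF i)).hasFDerivAt
    have hc' : fderiv ℝ c p = _ := ((hF' 3).fun_sub (h0.fun_mul (hF' 2))).fderiv
    have hd' : fderiv ℝ d p = _ := ((((hF' 1).fun_add ((h0.pow 2).fun_mul (hF' 2))).fun_sub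
      ((h0.const_mul 2).fun_mul (hF' 3))).const_mul 2⁻¹).fderiv
    have hcoord (i : Fin 4) (v : Fin 4 → ℝ) :
        fderiv ℝ (F i) p v = ∑ j, v j * fderiv ℝ (F i) p (Pi.single j 1) := by
      conv_lhs => rw [pi_eq_sum_univ' v]
      simp
    rw [← hdiv p hp]
    simp only [opX, opY, opZ, opW, hc', hd']
    simp [hcoord _ ![_, _, _, _], Fin.sum_univ_four]
    ring
  linarith
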